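/- arXiv:0806.0714 — 5 statements merged into one kernel-verified Lean document; each statement's English description precedes it below -/
import Mathlib

section
/- For every θ with β̂ < θ < π/2 one has δ(θ) < −δ'(θ)·(π/2 − θ); equivalently, since δ(θ) > 0 and δ'(θ) < 0 on this interval, δ'(θ)/δ(θ) < −2/(π − 2θ). (This follows from the strict convexity of δ on (β̂, π/2) together with δ(π/2) = 0.) -/
open Real

theorem cos_lt_of_arccos_lt {r t : ℝ} (h1 : arccos r < t) (h2 : t ≤ π / 2) :
    cos t < r := by
  by_contra! h
  have := arccos_le_arccos h
  rw [arccos_cos ((arccos_nonneg r).trans h1.le) (by linarith [pi_pos])] at this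
  linarith

theorem hasDerivAt_sub_arccos_cos_div {r t : ℝ} (hr : 0 < r) (h0 : 0 ≤ cos t) (h : cos t < r) :
    HasDerivAt (fun x => x - arccos (cos x / r)) (1 - sin t / √(r ^ 2 - cos t ^ 2)) t := by
  have hlt : cos t / r < 1 := (div_lt_one hr).2 h
  have hge : 0 ≤ cos t / r := by positivity
  have hsq : √(r ^ 2 - cos t ^ 2) = r * √(1 - (cos t / r) ^ 2) := by
    rw [← sqrt_sq hr.le, ← sqrt_mul (sq_nonneg r), sqrt_sq hr.le]
    congr 1
    field_simp
  have hpos : 0 < √(1 - (cos t / r) ^ 2) := sqrt_pos.2 (by nlinarith)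
  have hd := (hasDerivAt_id t).sub
    ((hasDerivAt_arccos (by linarith) hlt.ne).comp t ((hasDerivAt_cos t).div_const r))
  refine hd.congr_deriv ?_
  rw [hsq]
  field_simp

theorem one_lt_sin_div_sqrt {r t : ℝ} (hr : 0 < r) (hr1 : r < 1) (h0 : 0 ≤ cos t)
    (h : cos t < r) (hs : 0 < sin t) : 1 < sin t / √(r ^ 2 - cos t ^ 2) := by
  have hp : 0 < r ^ 2 - cos t ^ 2 := by nlinarith
  rw [one_lt_div (sqrt_pos.2 hp), sqrt_lt' hs]
  nlinarith [sin_sq_add_cos_sq t]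

theorem sin_div_sqrt_lt_sin_div_sqrt {r s t : ℝ} (hr : 0 < r) (hr1 : r < 1) (h0 : 0 ≤ cos t)
    (hst : cos t < cos s) (h : cos s < r) (hs : 0 < sin s) :
    sin t / √(r ^ 2 - cos t ^ 2) < sin s / √(r ^ 2 - cos s ^ 2) := by
  have hps : 0 < r ^ 2 - cos s ^ 2 := by nlinarith
  have hpt : 0 < r ^ 2 - cos t ^ 2 := by nlinarith
  refine lt_of_pow_lt_pow_left₀ 2 (by positivity) ?_
  rw [div_pow, div_pow, sq_sqrt hps.le, sq_sqrt hpt.le, div_lt_div_iff₀ hpt hps, sin_sq, sin_sq]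
  have hsq : cos t ^ 2 < cos s ^ 2 := by nlinarith
  nlinarith [mul_pos (sub_pos.2 hsq) (show 0 < 1 - r ^ 2 by nlinarith)]

/-- For every θ ∈ (β̂, π/2): δ(θ) < −δ'(θ)·(π/2 − θ), and equivalently
δ'(θ)/δ(θ) < −2/(π − 2θ), where δ(θ) = θ − arccos(cos θ / r) and
δ'(θ) = 1 − sin θ / √(r² − cos² θ). -/
theorem stmt_6 (r : ℝ) (hr0 : 0 < r) (hr1 : r < 1) (θ : ℝ)
    (hθ1 : Real.arccos r < θ) (hθ2 : θ < π / 2) :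
    (θ - Real.arccos (Real.cos θ / r)
      < -(1 - Real.sin θ / Real.sqrt (r ^ 2 - Real.cos θ ^ 2)) * (π / 2 - θ)) ∧
    (1 - Real.sin θ / Real.sqrt (r ^ 2 - Real.cos θ ^ 2))
        / (θ - Real.arccos (Real.cos θ / r))
      < -2 / (π - 2 * θ) := by
  have hpi := pi_pos
  have hθ0 : 0 < θ := (arccos_nonneg r).trans_lt hθ1
  have hcos : ∀ x ∈ Set.Icc θ (π / 2), 0 ≤ cos x ∧ cos x < r := fun x hx =>
    ⟨cos_nonneg_of_mem_Icc ⟨by linarith [hx.1], hx.2⟩,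
      cos_lt_of_arccos_lt (hθ1.trans_le hx.1) hx.2⟩
  have hder : ∀ x ∈ Set.Icc θ (π / 2), HasDerivAt (fun x => x - arccos (cos x / r))
      (1 - sin x / √(r ^ 2 - cos x ^ 2)) x := fun x hx =>
    hasDerivAt_sub_arccos_cos_div hr0 (hcos x hx).1 (hcos x hx).2
  obtain ⟨c, hc, hslope⟩ := exists_hasDerivAt_eq_slope _ _ hθ2
    (fun x hx => (hder x hx).continuousAt.continuousWithinAt)
    (fun x hx => hder x (Set.Ioo_subset_Icc_self hx))
  have hcI := Set.Ioo_subset_Icc_self hc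
  have hsinθ : 0 < sin θ := sin_pos_of_pos_of_lt_pi hθ0 (by linarith)
  have hsinc : 0 < sin c := sin_pos_of_pos_of_lt_pi (hθ0.trans hc.1) (by linarith [hc.2])
  have hgap : 0 < π / 2 - θ := by linarith
  rw [cos_pi_div_two, zero_div, arccos_zero, sub_self, zero_sub, eq_div_iff hgap.ne'] at hslope
  have hneg := one_lt_sin_div_sqrt hr0 hr1 (hcos c hcI).1 (hcos c hcI).2 hsinc
  have hmono := sin_div_sqrt_lt_sin_div_sqrt hr0 hr1 (hcos c hcI).1
    (cos_lt_cos_of_nonneg_of_le_pi_div_two hθ0.le hc.2.le hc.1)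
    (hcos θ ⟨le_rfl, hθ2.le⟩).2 hsinθ
  have hpos : 0 < θ - arccos (cos θ / r) := by nlinarith
  have hmain : θ - arccos (cos θ / r)
      < -(1 - sin θ / √(r ^ 2 - cos θ ^ 2)) * (π / 2 - θ) := by nlinarith
  refine ⟨hmain, ?_⟩
  rw [div_lt_div_iff₀ hpos (by linarith)]
  linarith
end

section
/- Let α > 0 be a real number. For every θ with β̂ < θ < π/2 and every integer n ≥ 1 satisfying 0 ≤ α − 2nδ(θ) < 2δ(θ), one has 2nδ'(θ) < −2(α − 2δ(θ))/(π − 2θ). -/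
open Real

/-- On `[0, π]` the function `x ↦ sin x / x` is nonincreasing, in division-free form. -/
theorem mul_sin_le_mul_sin {d s : ℝ} (hd : 0 ≤ d) (hds : d ≤ s) (hs : s ≤ π) :
    d * sin s ≤ s * sin d := by
  rcases (hd.trans hds).eq_or_lt with rfl | hs0
  · simp [le_antisymm hds hd]
  have hs_mem : s ∈ Set.Icc 0 π := ⟨hs0.le, hs⟩
  have h0_mem : (0 : ℝ) ∈ Set.Icc 0 π := ⟨le_rfl, pi_pos.le⟩
  have h := strictConcaveOn_sin_Icc.concaveOn.2 hs_mem h0_mem (div_nonneg hd hs0.le)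
    (sub_nonneg.2 ((div_le_one hs0).2 hds)) (add_sub_cancel (d / s) 1)
  simp only [smul_eq_mul, sin_zero, mul_zero, add_zero, div_mul_cancel₀ d hs0.ne'] at h
  rw [div_mul_eq_mul_div, div_le_iff₀ hs0] at h
  linarith

/-- On `(0, π / 2]` the function `x ↦ x * cos x / sin x` is nonincreasing, in division-free
form. -/
theorem mul_cos_mul_sin_le {φ ψ : ℝ} (hφ : 0 ≤ φ) (h : φ ≤ ψ) (hψ : ψ ≤ π / 2) :
    ψ * cos ψ * sin φ ≤ φ * cos φ * sin ψ := by
  have key := mul_sin_le_mul_sin (d := ψ - φ) (s := ψ + φ) (by linarith) (by linarith)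
    (by linarith)
  rw [sin_add, sin_sub] at key
  linarith

/-- Let α > 0. For every θ ∈ (β̂, π/2) and integer n ≥ 1 with
0 ≤ α − 2nδ(θ) < 2δ(θ), one has 2nδ'(θ) < −2(α − 2δ(θ))/(π − 2θ). -/
theorem stmt_7 (r : ℝ) (hr0 : 0 < r) (hr1 : r < 1) (α : ℝ) (hα : 0 < α)
    (θ : ℝ) (hθ1 : Real.arccos r < θ) (hθ2 : θ < π / 2)
    (n : ℕ) (hn : 1 ≤ n)
    (h1 : 0 ≤ α - 2 * n * (θ - Real.arccos (Real.cos θ / r)))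
    (h2 : α - 2 * n * (θ - Real.arccos (Real.cos θ / r))
      < 2 * (θ - Real.arccos (Real.cos θ / r))) :
    2 * n * (1 - Real.sin θ / Real.sqrt (r ^ 2 - Real.cos θ ^ 2))
      < -2 * (α - 2 * (θ - Real.arccos (Real.cos θ / r))) / (π - 2 * θ) := by
  have hθ0 : 0 < θ := (arccos_nonneg r).trans_lt hθ1
  have hcos : 0 < cos θ := cos_pos_of_mem_Ioo ⟨by linarith, hθ2⟩
  have hcr : cos θ < r := by
    have := cos_lt_cos_of_nonneg_of_le_pi (arccos_nonneg r) (by linarith) hθ1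
    rwa [cos_arccos (by linarith) hr1.le] at this
  have hq0 : 0 ≤ cos θ / r := by positivity
  have hq1 : cos θ / r < 1 := (div_lt_one hr0).2 hcr
  set γ := arccos (cos θ / r) with hγ
  have hcosγ : cos γ = cos θ / r := cos_arccos (by linarith) hq1.le
  have hγ0 : 0 < γ := arccos_pos.2 hq1
  have hγθ : γ ≤ θ := by
    rw [hγ, ← arccos_cos hθ0.le (by linarith : θ ≤ π)]
    apply arccos_le_arccos
    rw [arccos_cos hθ0.le (by linarith : θ ≤ π), le_div_iff₀ hr0]
    nlinarith
  have hsinγ : 0 < sin γ := sin_pos_of_pos_of_lt_pi hγ0 (by linarith)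
  have hcr' : cos θ = r * cos γ := by rw [hcosγ]; field_simp
  have hsqrt : √(r ^ 2 - cos θ ^ 2) = r * sin γ := by
    rw [← sqrt_sq (by positivity : 0 ≤ r * sin γ)]
    congr 1
    rw [hcr', mul_pow, mul_pow, sin_sq]
    ring
  have hmono := mul_cos_mul_sin_le (φ := π / 2 - θ) (ψ := π / 2 - γ) (by linarith)
    (by linarith) (by linarith)
  simp only [cos_pi_div_two_sub, sin_pi_div_two_sub] at hmono
  have hcosγ0 : 0 < cos γ := by rw [hcosγ]; positivity
  have hmono' : (π / 2 - γ) * (r * sin γ) ≤ (π / 2 - θ) * sin θ := by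
    refine le_of_mul_le_mul_right ?_ hcosγ0
    rw [hcr'] at hmono
    linarith
  have hn0 : (0 : ℝ) < n := by exact_mod_cast hn
  have hslope : (1 - sin θ / (r * sin γ)) * (π - 2 * θ) ≤ -2 * (θ - γ) := by
    have : π / 2 - γ ≤ (π / 2 - θ) * (sin θ / (r * sin γ)) := by
      rw [← mul_div_assoc, le_div_iff₀ (by positivity)]
      exact hmono'
    linarith
  rw [hsqrt, lt_div_iff₀ (by linarith)]
  have := mul_le_mul_of_nonneg_left hslope hn0.le
  linarith
end

section
/- Suppose α ≥ π. Then there exists a real constant c > 2, depending only on α and r, such that for every θ with β̂ < θ < π/2 and every integer n ≥ 1 satisfying 0 ≤ α − 2nδ(θ) < 2δ(θ), one has 2nδ'(θ) ≤ −c. -/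
open Real

/-- Suppose α ≥ π (circular guide of type A). Then there is c > 2 (depending
only on α and r) such that for every θ ∈ (β̂, π/2) and integer n ≥ 1 with
0 ≤ α − 2nδ(θ) < 2δ(θ), one has 2nδ'(θ) ≤ −c. -/
theorem stmt_8 (r : ℝ) (hr0 : 0 < r) (hr1 : r < 1) (α : ℝ) (hα : π ≤ α) :
    ∃ c : ℝ, 2 < c ∧ ∀ θ : ℝ, Real.arccos r < θ → θ < π / 2 →
      ∀ n : ℕ, 1 ≤ n →
      0 ≤ α - 2 * n * (θ - Real.arccos (Real.cos θ / r)) →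
      α - 2 * n * (θ - Real.arccos (Real.cos θ / r))
        < 2 * (θ - Real.arccos (Real.cos θ / r)) →
      2 * n * (1 - Real.sin θ / Real.sqrt (r ^ 2 - Real.cos θ ^ 2)) ≤ -c := by
  refine ⟨4, by norm_num, fun θ hθ1 hθ2 n hn h1 h2 => ?_⟩
  have hθ0 : 0 < θ := (Real.arccos_nonneg r).trans_lt hθ1
  have hcos : 0 < cos θ := cos_pos_of_mem_Ioo ⟨by linarith, hθ2⟩
  have hcosr : cos θ < r := by
    have h := Real.cos_lt_cos_of_nonneg_of_le_pi (Real.arccos_nonneg r)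
      (by linarith [pi_pos]) hθ1
    rwa [Real.cos_arccos (by linarith) hr1.le] at h
  have hq0 : 0 < cos θ / r := div_pos hcos hr0
  have hq1 : cos θ / r < 1 := (div_lt_one hr0).2 hcosr
  have hη0 : 0 < Real.arccos (cos θ / r) := Real.arccos_pos.2 hq1
  have hηπ : Real.arccos (cos θ / r) < π / 2 := Real.arccos_lt_pi_div_two.2 hq0
  have hcη : cos θ = r * cos (Real.arccos (cos θ / r)) := by
    rw [Real.cos_arccos (by linarith) hq1.le]
    field_simp
  generalize Real.arccos (cos θ / r) = η at *
  have hsη : 0 < sin η := sin_pos_of_pos_of_lt_pi hη0 (by linarith)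
  have hsqrt : Real.sqrt (r ^ 2 - cos θ ^ 2) = r * sin η := by
    have h : r ^ 2 - cos θ ^ 2 = (r * sin η) ^ 2 := by
      rw [hcη]
      linear_combination (-r ^ 2) * sin_sq_add_cos_sq η
    rw [h, Real.sqrt_sq (by positivity)]
  rw [hsqrt]
  have hδ0 : 0 < θ - η := by linarith
  have hjordan : 2 / π * (θ - η) ≤ sin (θ - η) := mul_le_sin hδ0.le (by linarith)
  have hsin : 1 ≤ (n + 1) * sin (θ - η) := by
    have h : 1 ≤ (n + 1) * (2 / π * (θ - η)) := by
      have e : (n + 1) * (2 / π * (θ - η)) = (2 * (n + 1) * (θ - η)) / π := by ring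
      rw [e, le_div_iff₀ pi_pos]
      linarith
    exact h.trans (by gcongr)
  have htwice : 2 * (cos θ * sin η) ≤ n * sin (θ - η) := by
    have h : 2 * (cos θ * sin η) = sin (θ + η) - sin (θ - η) := by
      rw [sin_add, sin_sub]
      ring
    linarith [sin_le_one (θ + η)]
  have hderiv : 1 - sin θ / (r * sin η) = -(sin (θ - η) / (cos θ * sin η)) := by
    have hr : r = cos θ / cos η := by
      rw [eq_div_iff (by rintro h; simp [h] at hcη; linarith), ← hcη]
    have hc : cos η ≠ 0 := by
      rintro h
      simp [h] at hcη
      linarith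
    rw [hr, sin_sub]
    field_simp
    ring
  rw [hderiv]
  have h : 2 ≤ n * sin (θ - η) / (cos θ * sin η) := (le_div_iff₀ (by positivity)).2 htwice
  rw [mul_div_assoc] at h
  linarith
end

section
/- Suppose 0 < r < 1/2. For every θ with β̂ < θ < π − β̂ and every integer n ≥ 1, setting χ = 2n·(1 − sin θ / √(r² − cos² θ)), one has sin θ · χ/(χ + 2) ≤ (1 − r)/(1 − 2r). (This is the bound on the focal length of a circular guide of type B.) -/
open Real

/-- Suppose 0 < r < 1/2 (type B guide). For every θ ∈ (β̂, π − β̂) and integer n ≥ 1,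
setting χ = 2n·(1 − sin θ / √(r² − cos² θ)), one has
sin θ · χ/(χ + 2) ≤ (1 − r)/(1 − 2r). -/
theorem stmt_11 (r : ℝ) (hr0 : 0 < r) (hr1 : r < 1 / 2) (θ : ℝ)
    (hθ1 : Real.arccos r < θ) (hθ2 : θ < π - Real.arccos r) (n : ℕ) (hn : 1 ≤ n) :
    Real.sin θ * ((2 * n * (1 - Real.sin θ / Real.sqrt (r ^ 2 - Real.cos θ ^ 2))) /
      (2 * n * (1 - Real.sin θ / Real.sqrt (r ^ 2 - Real.cos θ ^ 2)) + 2))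
      ≤ (1 - r) / (1 - 2 * r) := by
  have hβ0 : 0 ≤ arccos r := arccos_nonneg r
  have hθ0 : 0 < θ := hβ0.trans_lt hθ1
  have hθπ : θ < π := by linarith
  have hs : 0 < sin θ := sin_pos_of_pos_of_lt_pi hθ0 hθπ
  have hcos : cos (arccos r) = r := cos_arccos (by linarith) (by linarith)
  have hc1 : cos θ < r := by
    simpa only [hcos] using cos_lt_cos_of_nonneg_of_le_pi hβ0 hθπ.le hθ1
  have hc2 : -r < cos θ := by
    simpa only [cos_pi_sub, hcos] using
      cos_lt_cos_of_nonneg_of_le_pi hθ0.le (by linarith : π - arccos r ≤ π) hθ2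
  have hpos : 0 < r ^ 2 - cos θ ^ 2 := by nlinarith
  have hq : 0 < √(r ^ 2 - cos θ ^ 2) := sqrt_pos.2 hpos
  have hqs : √(r ^ 2 - cos θ ^ 2) ≤ r * sin θ := by
    refine sqrt_le_iff.2 ⟨by positivity, ?_⟩
    rw [mul_pow, sin_sq]
    have hr2 : r ^ 2 ≤ 1 := by nlinarith
    nlinarith [mul_nonneg (sub_nonneg.2 hr2) (sq_nonneg (cos θ))]
  have hratio : 1 ≤ r * (sin θ / √(r ^ 2 - cos θ ^ 2)) := by
    rwa [← mul_div_assoc, one_le_div hq]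
  generalize sin θ / √(r ^ 2 - cos θ ^ 2) = t at hratio ⊢
  have hn' : (1 : ℝ) ≤ n := by exact_mod_cast hn
  have hw : 1 - r ≤ r * (n * (t - 1)) := by
    nlinarith [mul_nonneg (sub_nonneg.2 hn') (by linarith : 0 ≤ r * t - r)]
  have hw1 : 1 < n * (t - 1) := by
    by_contra! h
    nlinarith [mul_le_mul_of_nonneg_left h hr0.le]
  have hχ : 2 * n * (1 - t) / (2 * n * (1 - t) + 2) = n * (t - 1) / (n * (t - 1) - 1) := by
    rw [div_eq_div_iff (by linarith) (by linarith)]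
    ring
  rw [hχ]
  refine (mul_le_of_le_one_left (div_nonneg (by linarith) (by linarith)) (sin_le_one θ)).trans ?_
  rw [div_le_div_iff₀ (by linarith) (by linarith)]
  linarith
end

section
/- Let a, b, c, d be real numbers with c ≠ 0 and ad − bc < 0, let f(x) = (ax + b)/(cx + d), and let τ₂ < τ₁ be its two real fixed points. Then the pole −d/c lies strictly between τ₂ and τ₁, and for every real x with cx + d ≠ 0 and x ∉ {τ₁, τ₂}, one has (x < τ₂ or x > τ₁) if and only if τ₂ < f(x) < τ₁. -/
theorem mul_sub_sub_neg_iff {s t : ℝ} (h : s < t) (y : ℝ) :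
    (y - s) * (y - t) < 0 ↔ s < y ∧ y < t := by
  rw [mul_neg_iff]
  constructor
  · rintro (⟨_, _⟩ | ⟨_, _⟩) <;> constructor <;> linarith
  · rintro ⟨_, _⟩
    left
    constructor <;> linarith

theorem mul_sub_sub_pos_iff {s t : ℝ} (h : s < t) (y : ℝ) :
    0 < (y - s) * (y - t) ↔ y < s ∨ t < y := by
  rw [mul_pos_iff]
  constructor
  · rintro (⟨_, _⟩ | ⟨_, _⟩)
    · right; linarith
    · left; linarith
  · rintro (_ | _)
    · right; constructor <;> linarith
    · left; constructor <;> linarith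

/-- Let f(x) = (ax + b)/(cx + d) with c ≠ 0 and ad − bc < 0, and let τ₂ < τ₁ be its
two real fixed points. Then the pole −d/c lies strictly between τ₂ and τ₁, and for
every x in the domain with x ∉ {τ₁, τ₂}: (x < τ₂ or x > τ₁) iff τ₂ < f(x) < τ₁. -/
theorem stmt_13 (a b c d : ℝ) (hc : c ≠ 0) (hdet : a * d - b * c < 0)
    (τ₁ τ₂ : ℝ) (hτ : τ₂ < τ₁)
    (h1 : c * τ₁ + d ≠ 0) (hf1 : (a * τ₁ + b) / (c * τ₁ + d) = τ₁)
    (h2 : c * τ₂ + d ≠ 0) (hf2 : (a * τ₂ + b) / (c * τ₂ + d) = τ₂) :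
    (τ₂ < -d / c ∧ -d / c < τ₁) ∧
    ∀ x : ℝ, c * x + d ≠ 0 → x ≠ τ₁ → x ≠ τ₂ →
      ((x < τ₂ ∨ τ₁ < x) ↔
        (τ₂ < (a * x + b) / (c * x + d) ∧ (a * x + b) / (c * x + d) < τ₁)) := by
  rw [div_eq_iff h1] at hf1
  rw [div_eq_iff h2] at hf2
  have ha : a = c * (τ₁ + τ₂) + d := by
    apply mul_right_cancel₀ (sub_ne_zero.mpr hτ.ne')
    linear_combination hf1 - hf2
  have hb : b = -(c * τ₁ * τ₂) := by
    linear_combination hf1 - τ₁ * ha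
  have hpole : (-d / c - τ₂) * (-d / c - τ₁) = (a * d - b * c) / c ^ 2 := by
    rw [ha, hb]
    field_simp
    ring
  refine ⟨(mul_sub_sub_neg_iff hτ _).mp ?_, fun x hx _ _ => ?_⟩
  · rw [hpole]
    exact div_neg_of_neg_of_pos hdet (by positivity)
  · have himage : ((a * x + b) / (c * x + d) - τ₂) * ((a * x + b) / (c * x + d) - τ₁) =
        (a * d - b * c) / (c * x + d) ^ 2 * ((x - τ₂) * (x - τ₁)) := by
      rw [ha, hb]
      field_simp
      ring
    have hneg : (a * d - b * c) / (c * x + d) ^ 2 < 0 :=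
      div_neg_of_neg_of_pos hdet (by positivity)
    rw [← mul_sub_sub_pos_iff hτ, ← mul_sub_sub_neg_iff hτ, himage]
    exact ⟨mul_neg_of_neg_of_pos hneg, fun h => pos_of_mul_neg_right h hneg.le⟩
end
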